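/- Let p ≥ 5 be a prime number and suppose w_1(p) ≢ 0 (mod 2). Then for all nonnegative integers n and k satisfying w_1(p) ≡ ( (−6n − 1 + (p²−1)/4) / p )_L (mod 2), we have B_{4,3}( p^{6k+2} n + 5(p^{6k+2} − 1)/24 ) ≡ 0 (mod 2). -/

import Mathlib

/-- The number of `t`-regular partitions of `n`, i.e. partitions of `n`
none of whose parts is divisible by `t`. -/
noncomputable def regularPartitionCount (t n : ℕ) : ℕ :=
  Nat.card {π : n.Partition // ∀ x ∈ π.parts, ¬ t ∣ x}

/-- `B u v n` is the number of `(u,v)`-regular bipartitions of `n`: pairs `(α, β)` of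
partitions with `|α| + |β| = n`, `α` being `u`-regular and `β` being `v`-regular. -/
noncomputable def B (u v n : ℕ) : ℕ :=
  ∑ i ∈ Finset.range (n + 1), regularPartitionCount u i * regularPartitionCount v (n - i)

/-- `a1 n` is the coefficient of `q^n` in `∏ (1 - q^k)^2 (1 - q^{3k})`. -/
noncomputable def a1 (n : ℕ) : ℤ :=
  (∏ k ∈ Finset.Icc 1 n,
      ((1 - Polynomial.X ^ k) ^ 2 * (1 - Polynomial.X ^ (3 * k)) : Polynomial ℤ)).coeff n

/-- `w1 p = a1(5(p²−1)/24) + (−6/p)_L (−5(p²−1)/24 / p)_L` for a prime `p ≥ 5`. -/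
noncomputable def w1 (p : ℕ) (hp : p.Prime) : ℤ :=
  a1 (5 * (p ^ 2 - 1) / 24)
    + @legendreSym p ⟨hp⟩ (-6) * @legendreSym p ⟨hp⟩ (-((5 * (p ^ 2 - 1) / 24 : ℕ) : ℤ))


/-- The solutions of `2x² + 3y² = M` with `x ≡ 1` and `y ≡ s` modulo `3`. -/
noncomputable def reps (M : ℕ) (s : ℤ) : Finset (ℤ × ℤ) :=
  (Finset.Icc (-(M : ℤ)) M ×ˢ Finset.Icc (-(M : ℤ)) M).filter fun z =>
    2 * z.1 ^ 2 + 3 * z.2 ^ 2 = M ∧ z.1 % 3 = 1 ∧ z.2 % 3 = s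

theorem mem_reps {M : ℕ} {s : ℤ} {z : ℤ × ℤ} :
    z ∈ reps M s ↔ 2 * z.1 ^ 2 + 3 * z.2 ^ 2 = M ∧ z.1 % 3 = 1 ∧ z.2 % 3 = s := by
  simp only [reps, Finset.mem_filter, Finset.mem_product, Finset.mem_Icc, and_iff_right_iff_imp]
  rintro ⟨h, -, -⟩
  have h1 := Int.le_self_sq z.1
  have h2 := Int.le_self_sq z.2
  have h3 := Int.le_self_sq (-z.1)
  have h4 := Int.le_self_sq (-z.2)
  refine ⟨⟨?_, ?_⟩, ?_, ?_⟩ <;> nlinarith [sq_nonneg z.1, sq_nonneg z.2]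

theorem card_reps_two (M : ℕ) : (reps M 2).card = (reps M 1).card := by
  refine Finset.card_nbij' (fun z => (z.1, -z.2)) (fun z => (z.1, -z.2)) ?_ ?_ ?_ ?_ <;>
    simp only [Set.MapsTo, Set.LeftInvOn, Finset.mem_coe, mem_reps, neg_sq, neg_neg, Prod.mk.eta,
      implies_true]
  · exact fun z hz => ⟨hz.1, hz.2.1, by lia⟩
  · exact fun z hz => ⟨hz.1, hz.2.1, by lia⟩

theorem even_card_reps_zero {M : ℕ} (hM : Odd M) : Even (reps M 0).card := by
  rw [← ZMod.natCast_eq_zero_iff_even, Finset.card_eq_sum_ones, Nat.cast_sum]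
  refine Finset.sum_involution (fun z _ => (z.1, -z.2)) (fun _ _ => by decide) ?_ ?_ ?_
  · rintro ⟨x, y⟩ hz - h
    rw [mem_reps] at hz
    have hy : y = 0 := by
      have : -y = y := congrArg Prod.snd h
      linarith
    clear h
    subst hy
    obtain ⟨m, rfl⟩ := hM
    have := hz.1
    push_cast at this
    lia
  · intro z hz
    rw [mem_reps] at hz ⊢
    exact ⟨by simpa using hz.1, hz.2.1, Int.emod_eq_zero_of_dvd (Int.dvd_neg.mpr (Int.dvd_of_emod_eq_zero hz.2.2))⟩
  · simp

/-- Multiplication by `u + v√-6` on pairs `(x, y)` standing for `2x + y√-6`. -/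
def twist (u v : ℤ) (z : ℤ × ℤ) : ℤ × ℤ := (u * z.1 - 3 * v * z.2, u * z.2 + 2 * v * z.1)

theorem twist_neg_twist (u v : ℤ) (z : ℤ × ℤ) :
    twist u (-v) (twist u v z) = ((u ^ 2 + 6 * v ^ 2) * z.1, (u ^ 2 + 6 * v ^ 2) * z.2) := by
  simp only [twist, Prod.mk.injEq]
  constructor <;> ring

theorem twist_injective {u v : ℤ} (h : u ^ 2 + 6 * v ^ 2 ≠ 0) : Function.Injective (twist u v) := by
  intro z w hzw
  have := congrArg (twist u (-v)) hzw
  simp only [twist_neg_twist, Prod.mk.injEq, mul_right_inj' h] at this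
  exact Prod.ext this.1 this.2

theorem twist_mem_reps {p M : ℕ} {u v s : ℤ} (huv : u ^ 2 + 6 * v ^ 2 = (p : ℤ) ^ 2)
    (hu : u % 3 = 1) {z : ℤ × ℤ} (hz : z ∈ reps M s) :
    twist u v z ∈ reps (p ^ 2 * M) ((s + 2 * v) % 3) := by
  obtain ⟨x, y⟩ := z
  simp only [mem_reps, twist] at hz ⊢
  obtain ⟨h1, h2, h3⟩ := hz
  obtain ⟨a, ha⟩ : ∃ a, u = 3 * a + 1 := ⟨u / 3, by lia⟩
  obtain ⟨b, hb⟩ : ∃ b, x = 3 * b + 1 := ⟨x / 3, by lia⟩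
  refine ⟨?_, ?_, ?_⟩
  · push_cast
    rw [← h1, ← huv]
    ring
  · have : u * x - 3 * v * y = 3 * (3 * a * b + a + b - v * y) + 1 := by rw [ha, hb]; ring
    lia
  · have : u * y + 2 * v * x = 3 * (a * y + 2 * v * b) + (y + 2 * v) := by rw [ha, hb]; ring
    lia

section Prime

variable {p : ℕ} {u v : ℤ}

theorem not_dvd_of_sq_add (hp : p.Prime) (hp5 : 5 ≤ p) (huv : u ^ 2 + 6 * v ^ 2 = (p : ℤ) ^ 2)
    (hv : ¬ (p : ℤ) ∣ v) : ¬ (p : ℤ) ∣ u := by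
  intro hu
  have hp' := Nat.prime_iff_prime_int.mp hp
  have h6 : (p : ℤ) ∣ 6 * v ^ 2 := by
    have : 6 * v ^ 2 = (p : ℤ) ^ 2 - u ^ 2 := by linarith
    rw [this]
    exact dvd_sub (dvd_pow_self _ two_ne_zero) (dvd_pow hu two_ne_zero)
  rcases hp'.dvd_or_dvd h6 with h | h
  · have h' : p ∣ 6 := by exact_mod_cast h
    have := Nat.le_of_dvd (by norm_num) h'
    interval_cases p
    · lia
    · exact absurd hp (by norm_num)
  · exact hv (hp'.dvd_of_dvd_pow h)

theorem sq_emod_three (hp : p.Prime) (hp5 : 5 ≤ p) : (p : ℤ) ^ 2 % 3 = 1 := by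
  have h : ¬ 3 ∣ p := fun h => by
    have := (Nat.prime_dvd_prime_iff_eq Nat.prime_three hp).mp h
    lia
  have : (p : ℤ) % 3 = 1 ∨ (p : ℤ) % 3 = 2 := by lia
  rcases this with h | h <;> simp [pow_two, Int.mul_emod, h]

/-- The pairs divisible by `u + v√-6` are detected by the conjugate. -/
theorem mem_image_twist {M : ℕ} (hp : p.Prime) (hp5 : 5 ≤ p)
    (huv : u ^ 2 + 6 * v ^ 2 = (p : ℤ) ^ 2) (hu : u % 3 = 1) (hv : ¬ (p : ℤ) ∣ v)
    {z : ℤ × ℤ} (hz : z ∈ reps (p ^ 2 * M) 1)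
    (hd : (p : ℤ) ^ 2 ∣ u * z.1 + 3 * v * z.2) :
    z ∈ (reps M ((1 + v) % 3)).image (twist u v) := by
  obtain ⟨X, Y⟩ := z
  simp only [mem_reps] at hz hd
  obtain ⟨h1, h2, h3⟩ := hz
  have hp' := Nat.prime_iff_prime_int.mp hp
  have hpu := not_dvd_of_sq_add hp hp5 huv hv
  have hp0 : (p : ℤ) ^ 2 ≠ 0 := pow_ne_zero _ hp'.ne_zero
  have hd' : (p : ℤ) ^ 2 ∣ u * Y - 2 * v * X := by
    have hc : IsCoprime ((p : ℤ) ^ 2) u := ((hp'.coprime_iff_not_dvd).mpr hpu).pow_left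
    refine hc.dvd_of_dvd_mul_left ?_
    have : u * (u * Y - 2 * v * X) = (p : ℤ) ^ 2 * Y - 2 * v * (u * X + 3 * v * Y) := by
      rw [← huv]; ring
    rw [this]
    exact dvd_sub (dvd_mul_right _ _) (hd.mul_left _)
  obtain ⟨x, hx⟩ := hd
  obtain ⟨y, hy⟩ := hd'
  obtain ⟨c, hc⟩ : ∃ c, (p : ℤ) ^ 2 = 3 * c + 1 :=
    ⟨(p : ℤ) ^ 2 / 3, by have := sq_emod_three hp hp5; lia⟩
  obtain ⟨a, ha⟩ : ∃ a, u = 3 * a + 1 := ⟨u / 3, by lia⟩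
  obtain ⟨b, hb⟩ : ∃ b, X = 3 * b + 1 := ⟨X / 3, by lia⟩
  obtain ⟨d, he⟩ : ∃ d, Y = 3 * d + 1 := ⟨Y / 3, by lia⟩
  rw [Finset.mem_image]
  refine ⟨(x, y), ?_, ?_⟩
  · rw [mem_reps]
    refine ⟨?_, ?_, ?_⟩
    · apply mul_left_cancel₀ (pow_ne_zero 2 hp0)
      push_cast at h1
      calc ((p : ℤ) ^ 2) ^ 2 * (2 * x ^ 2 + 3 * y ^ 2)
          = 2 * ((p : ℤ) ^ 2 * x) ^ 2 + 3 * ((p : ℤ) ^ 2 * y) ^ 2 := by ring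
        _ = (u ^ 2 + 6 * v ^ 2) * (2 * X ^ 2 + 3 * Y ^ 2) := by rw [← hx, ← hy]; ring
        _ = _ := by rw [huv, h1]; ring
    · have : x = 3 * (3 * a * b + a + b + v * Y - c * x) + 1 := by
        rw [hc, ha, hb] at hx; linarith
      simp only
      lia
    · have : y = 3 * (3 * a * d + a + d - 2 * v * b - v - c * y) + (1 + v) := by
        rw [hc, ha, hb, he] at hy; linarith
      simp only
      lia
  · simp only [twist, Prod.mk.injEq]
    constructor <;> apply mul_left_cancel₀ hp0
    · calc (p : ℤ) ^ 2 * (u * x - 3 * v * y)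
          = u * ((p : ℤ) ^ 2 * x) - 3 * v * ((p : ℤ) ^ 2 * y) := by ring
        _ = (p : ℤ) ^ 2 * X := by rw [← hx, ← hy, ← huv]; ring
    · calc (p : ℤ) ^ 2 * (u * y + 2 * v * x)
          = u * ((p : ℤ) ^ 2 * y) + 2 * v * ((p : ℤ) ^ 2 * x) := by ring
        _ = (p : ℤ) ^ 2 * Y := by rw [← hx, ← hy, ← huv]; ring

theorem dvd_of_mem_image_twist {s : Finset (ℤ × ℤ)} (huv : u ^ 2 + 6 * v ^ 2 = (p : ℤ) ^ 2)
    {z : ℤ × ℤ} (hz : z ∈ s.image (twist u v)) : (p : ℤ) ^ 2 ∣ u * z.1 + 3 * v * z.2 := by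
  obtain ⟨w, -, rfl⟩ := Finset.mem_image.mp hz
  exact ⟨w.1, by rw [← huv]; simp only [twist]; ring⟩

theorem dvd_add_or_dvd_sub (hp : p.Prime) (hp5 : 5 ≤ p)
    (huv : u ^ 2 + 6 * v ^ 2 = (p : ℤ) ^ 2) (hv : ¬ (p : ℤ) ∣ v)
    {X Y : ℤ} (h : (p : ℤ) ^ 2 ∣ 2 * X ^ 2 + 3 * Y ^ 2) :
    (p : ℤ) ^ 2 ∣ u * X + 3 * v * Y ∨ (p : ℤ) ^ 2 ∣ u * X - 3 * v * Y ∨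
      ((p : ℤ) ∣ X ∧ (p : ℤ) ∣ Y) := by
  have hp' := Nat.prime_iff_prime_int.mp hp
  have hpu := not_dvd_of_sq_add hp hp5 huv hv
  have hprod : (p : ℤ) ^ 2 ∣ (u * X + 3 * v * Y) * (u * X - 3 * v * Y) := by
    have : (u * X + 3 * v * Y) * (u * X - 3 * v * Y)
        = (p : ℤ) ^ 2 * X ^ 2 - 3 * v ^ 2 * (2 * X ^ 2 + 3 * Y ^ 2) := by rw [← huv]; ring
    rw [this]
    exact dvd_sub (dvd_mul_right _ _) (h.mul_left _)
  have hsmall : ∀ m : ℕ, 0 < m → m < 5 → ¬ (p : ℤ) ∣ m := fun m h0 h5 hd => by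
    have := Nat.le_of_dvd h0 (by exact_mod_cast hd)
    lia
  by_cases hA : (p : ℤ) ∣ u * X + 3 * v * Y
  · by_cases hB : (p : ℤ) ∣ u * X - 3 * v * Y
    · right; right
      have hX : (p : ℤ) ∣ X := by
        have h2 : (p : ℤ) ∣ 2 * (u * X) := by
          have e : 2 * (u * X) = (u * X + 3 * v * Y) + (u * X - 3 * v * Y) := by ring
          exact e ▸ dvd_add hA hB
        rcases hp'.dvd_or_dvd h2 with h | h
        · exact absurd h (hsmall 2 (by lia) (by lia))
        · exact (hp'.dvd_or_dvd h).resolve_left hpu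
      refine ⟨hX, ?_⟩
      have h3 : (p : ℤ) ∣ 3 * (v * Y) := by
        have e : 3 * (v * Y) = (u * X + 3 * v * Y) - u * X := by ring
        exact e ▸ dvd_sub hA (hX.mul_left u)
      rcases hp'.dvd_or_dvd h3 with h | h
      · exact absurd h (hsmall 3 (by lia) (by lia))
      · exact (hp'.dvd_or_dvd h).resolve_left hv
    · left
      exact (((hp'.coprime_iff_not_dvd).mpr hB).pow_left).dvd_of_dvd_mul_right hprod
  · right; left
    exact (((hp'.coprime_iff_not_dvd).mpr hA).pow_left).dvd_of_dvd_mul_left hprod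

theorem dvd_add_or_dvd_sub_of_pow_four (hp : p.Prime) (hp5 : 5 ≤ p)
    (huv : u ^ 2 + 6 * v ^ 2 = (p : ℤ) ^ 2) (hv : ¬ (p : ℤ) ∣ v)
    {X Y : ℤ} (h : (p : ℤ) ^ 4 ∣ 2 * X ^ 2 + 3 * Y ^ 2) :
    (p : ℤ) ^ 2 ∣ u * X + 3 * v * Y ∨ (p : ℤ) ^ 2 ∣ u * X - 3 * v * Y := by
  have hp' := Nat.prime_iff_prime_int.mp hp
  rcases dvd_add_or_dvd_sub hp hp5 huv hv ((pow_dvd_pow _ (by lia)).trans h) with h1 | h1 | h1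
  · exact .inl h1
  · exact .inr h1
  obtain ⟨⟨x, rfl⟩, ⟨y, rfl⟩⟩ := h1
  have h2 : (p : ℤ) ^ 2 ∣ 2 * x ^ 2 + 3 * y ^ 2 := by
    apply (mul_dvd_mul_iff_left (pow_ne_zero 2 hp'.ne_zero)).mp
    have e : (p : ℤ) ^ 2 * (2 * x ^ 2 + 3 * y ^ 2) = 2 * (p * x) ^ 2 + 3 * (p * y) ^ 2 := by ring
    rwa [e, ← pow_add]
  have key : ∀ {a b : ℤ}, (p : ℤ) ∣ a → b = p * a → (p : ℤ) ^ 2 ∣ b := by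
    rintro a b ⟨c, rfl⟩ rfl
    exact ⟨c, by ring⟩
  rcases dvd_add_or_dvd_sub hp hp5 huv hv h2 with h1 | h1 | ⟨⟨a, rfl⟩, ⟨b, rfl⟩⟩
  · exact .inl (key ((dvd_pow_self _ two_ne_zero).trans h1) (by ring))
  · exact .inr (key ((dvd_pow_self _ two_ne_zero).trans h1) (by ring))
  · exact .inl ⟨u * a + 3 * v * b, by ring⟩

theorem dvd_sq_of_dvd_add_of_dvd_sub (hp : p.Prime) (hp5 : 5 ≤ p)
    (huv : u ^ 2 + 6 * v ^ 2 = (p : ℤ) ^ 2) (hv : ¬ (p : ℤ) ∣ v)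
    {X Y : ℤ} (hA : (p : ℤ) ^ 2 ∣ u * X + 3 * v * Y) (hB : (p : ℤ) ^ 2 ∣ u * X - 3 * v * Y) :
    (p : ℤ) ^ 2 ∣ X ∧ (p : ℤ) ^ 2 ∣ Y := by
  have hp' := Nat.prime_iff_prime_int.mp hp
  have hpu := not_dvd_of_sq_add hp hp5 huv hv
  have hsmall : ∀ m : ℕ, 0 < m → m < 5 → ¬ (p : ℤ) ∣ m := fun m h0 h5 hd => by
    have := Nat.le_of_dvd h0 (by exact_mod_cast hd)
    lia
  have cop : ∀ {a : ℤ}, ¬ (p : ℤ) ∣ a → IsCoprime ((p : ℤ) ^ 2) a := fun h =>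
    ((hp'.coprime_iff_not_dvd).mpr h).pow_left
  constructor
  · refine (cop hpu).dvd_of_dvd_mul_left ((cop (hsmall 2 (by lia) (by lia))).dvd_of_dvd_mul_left ?_)
    have := dvd_add hA hB
    convert this using 1
    ring
  · refine (cop hv).dvd_of_dvd_mul_left ((cop (hsmall 3 (by lia) (by lia))).dvd_of_dvd_mul_left
      ((cop (hsmall 2 (by lia) (by lia))).dvd_of_dvd_mul_left ?_))
    have := dvd_sub hA hB
    convert this using 1
    ring


theorem neg_parameters (huv : u ^ 2 + 6 * v ^ 2 = (p : ℤ) ^ 2) (hv : ¬ (p : ℤ) ∣ v) :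
    u ^ 2 + 6 * (-v) ^ 2 = (p : ℤ) ^ 2 ∧ ¬ (p : ℤ) ∣ -v :=
  ⟨by rw [neg_sq]; exact huv, by rwa [dvd_neg]⟩

theorem image_twist_subset {M : ℕ} (huv : u ^ 2 + 6 * v ^ 2 = (p : ℤ) ^ 2) (hu : u % 3 = 1) :
    (reps M ((1 + v) % 3)).image (twist u v) ⊆ reps (p ^ 2 * M) 1 := by
  intro z hz
  obtain ⟨w, hw, rfl⟩ := Finset.mem_image.mp hz
  have := twist_mem_reps huv hu hw
  rwa [show ((1 + v) % 3 + 2 * v) % 3 = 1 by lia] at this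

theorem mem_image_smul {M : ℕ} (hp : p.Prime) {q : ℤ} (hq : q ^ 2 = (p : ℤ) ^ 2)
    (hq3 : q % 3 = 1) {z : ℤ × ℤ} :
    z ∈ (reps M 1).image (q • ·) ↔ z ∈ reps (p ^ 2 * M) 1 ∧ (p : ℤ) ∣ z.1 ∧ (p : ℤ) ∣ z.2 := by
  obtain ⟨a, ha⟩ : ∃ a, q = 3 * a + 1 := ⟨q / 3, by lia⟩
  have hp0 : (p : ℤ) ≠ 0 := by exact_mod_cast hp.ne_zero
  have hqp : q ∣ p := (Int.pow_dvd_pow_iff two_ne_zero).mp hq.dvd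
  have hpq : (p : ℤ) ∣ q := (Int.pow_dvd_pow_iff two_ne_zero).mp hq.symm.dvd
  constructor
  · intro hz
    obtain ⟨⟨x, y⟩, hw, rfl⟩ := Finset.mem_image.mp hz
    simp only [mem_reps, Prod.smul_mk, smul_eq_mul] at hw ⊢
    obtain ⟨h1, h2, h3⟩ := hw
    refine ⟨⟨?_, ?_, ?_⟩, hpq.mul_right _, hpq.mul_right _⟩
    · push_cast
      rw [← h1, ← hq]
      ring
    · rw [ha, show (3 * a + 1) * x = 3 * (a * x) + x by ring]
      lia
    · rw [ha, show (3 * a + 1) * y = 3 * (a * y) + y by ring]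
      lia
  · obtain ⟨X, Y⟩ := z
    rintro ⟨hz, hX, hY⟩
    obtain ⟨x, rfl : X = q * x⟩ := hqp.trans hX
    obtain ⟨y, rfl : Y = q * y⟩ := hqp.trans hY
    refine Finset.mem_image.mpr ⟨(x, y), ?_, rfl⟩
    simp only [mem_reps] at hz ⊢
    obtain ⟨h1, h2, h3⟩ := hz
    rw [ha, show (3 * a + 1) * x = 3 * (a * x) + x by ring] at h2
    rw [ha, show (3 * a + 1) * y = 3 * (a * y) + y by ring] at h3
    refine ⟨?_, by lia, by lia⟩
    apply mul_left_cancel₀ (pow_ne_zero 2 hp0)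
    push_cast at h1
    rw [← h1, ← hq]
    ring

theorem card_reps_mul_sq_of_not_dvd {M : ℕ} (hp : p.Prime) (hp5 : 5 ≤ p)
    (huv : u ^ 2 + 6 * v ^ 2 = (p : ℤ) ^ 2) (hu : u % 3 = 1) (hv : ¬ (p : ℤ) ∣ v)
    (hM : ¬ p ∣ M) :
    (reps (p ^ 2 * M) 1).card =
      (reps M ((1 + v) % 3)).card + (reps M ((1 + -v) % 3)).card + (reps M 1).card := by
  obtain ⟨huv', hv'⟩ := neg_parameters huv hv
  have hp0 : (p : ℤ) ≠ 0 := by exact_mod_cast hp.ne_zero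
  obtain ⟨q, hq, hq3⟩ : ∃ q : ℤ, q ^ 2 = (p : ℤ) ^ 2 ∧ q % 3 = 1 := by
    have h3 := sq_emod_three hp hp5
    have : (p : ℤ) % 3 = 0 ∨ (p : ℤ) % 3 = 1 ∨ (p : ℤ) % 3 = 2 := by lia
    rcases this with h | h | h
    · simp [pow_two, Int.mul_emod, h] at h3
    · exact ⟨p, rfl, h⟩
    · exact ⟨-p, by ring, by lia⟩
  have hq0 : q ≠ 0 := by
    rintro rfl
    exact pow_ne_zero 2 hp0 (by rw [← hq]; norm_num)
  have hunion : reps (p ^ 2 * M) 1 =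
      ((reps M ((1 + v) % 3)).image (twist u v) ∪ (reps M ((1 + -v) % 3)).image (twist u (-v)))
        ∪ (reps M 1).image (q • ·) := by
    apply Finset.Subset.antisymm
    · intro z hz
      have h1 := (mem_reps.mp hz).1
      rcases dvd_add_or_dvd_sub hp hp5 huv hv (X := z.1) (Y := z.2)
        ⟨M, by rw [h1]; push_cast; ring⟩ with h | h | h
      · exact Finset.mem_union_left _ (Finset.mem_union_left _
          (mem_image_twist hp hp5 huv hu hv hz h))
      · refine Finset.mem_union_left _ (Finset.mem_union_right _
          (mem_image_twist hp hp5 huv' hu hv' hz ?_))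
        rwa [show u * z.1 + 3 * -v * z.2 = u * z.1 - 3 * v * z.2 by ring]
      · exact Finset.mem_union_right _ ((mem_image_smul hp hq hq3).mpr ⟨hz, h⟩)
    · refine Finset.union_subset (Finset.union_subset ?_ ?_) ?_
      · exact image_twist_subset huv hu
      · exact image_twist_subset huv' hu
      · exact fun z hz => ((mem_image_smul hp hq hq3).mp hz).1
  have hsub : ∀ w : ℤ, w ^ 2 = v ^ 2 → ∀ z ∈ reps (p ^ 2 * M) 1,
      (p : ℤ) ^ 2 ∣ u * z.1 + 3 * w * z.2 → ¬ ((p : ℤ) ∣ z.1 ∧ (p : ℤ) ∣ z.2) := by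
    rintro w hw ⟨_, _⟩ hz ⟨c, hc⟩ ⟨⟨x, rfl⟩, ⟨y, rfl⟩⟩
    have h1 := (mem_reps.mp hz).1
    have hM' : (M : ℤ) = 2 * x ^ 2 + 3 * y ^ 2 := by
      apply mul_left_cancel₀ (pow_ne_zero 2 hp0)
      push_cast at h1
      rw [← h1]
      ring
    have h2 : u * x + 3 * w * y = p * c := by
      apply mul_left_cancel₀ hp0
      linear_combination hc
    have hp' := Nat.prime_iff_prime_int.mp hp
    have h3 : (p : ℤ) ∣ 3 * (v ^ 2 * M) := by
      refine ⟨p * x ^ 2 - c * (u * x - 3 * w * y), ?_⟩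
      rw [hM']
      linear_combination x ^ 2 * huv - (u * x - 3 * w * y) * h2 - 9 * y ^ 2 * hw
    rcases hp'.dvd_or_dvd h3 with h | h
    · have := Nat.le_of_dvd (by norm_num) (show p ∣ 3 by exact_mod_cast h)
      lia
    · rcases hp'.dvd_or_dvd h with h | h
      · exact hv (hp'.dvd_of_dvd_pow h)
      · exact hM (by exact_mod_cast h)
  rw [hunion, Finset.card_union_of_disjoint, Finset.card_union_of_disjoint,
    Finset.card_image_of_injective _ (twist_injective (huv ▸ pow_ne_zero 2 hp0)),
    Finset.card_image_of_injective _ (twist_injective (huv' ▸ pow_ne_zero 2 hp0)),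
    Finset.card_image_of_injective _ (smul_right_injective _ hq0)]
  · rw [Finset.disjoint_left]
    intro z h1 h2
    have hd1 := dvd_of_mem_image_twist huv h1
    have hd2 := dvd_of_mem_image_twist huv' h2
    rw [show u * z.1 + 3 * -v * z.2 = u * z.1 - 3 * v * z.2 by ring] at hd2
    obtain ⟨h3, h4⟩ := dvd_sq_of_dvd_add_of_dvd_sub hp hp5 huv hv hd1 hd2
    exact hsub v rfl z (image_twist_subset huv hu h1) hd1
      ⟨(dvd_pow_self _ two_ne_zero).trans h3, (dvd_pow_self _ two_ne_zero).trans h4⟩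
  · rw [Finset.disjoint_left]
    intro z h1 h2
    obtain ⟨hz, hd⟩ := (mem_image_smul hp hq hq3).mp h2
    rcases Finset.mem_union.mp h1 with h | h
    · exact hsub v rfl z hz (dvd_of_mem_image_twist huv h) hd
    · exact hsub (-v) (neg_sq v) z hz (dvd_of_mem_image_twist huv' h) hd

theorem card_reps_mul_sq_of_dvd {M : ℕ} (hp : p.Prime) (hp5 : 5 ≤ p)
    (huv : u ^ 2 + 6 * v ^ 2 = (p : ℤ) ^ 2) (hu : u % 3 = 1) (hv : ¬ (p : ℤ) ∣ v) :
    (reps (p ^ 2 * (p ^ 2 * M)) 1).card + (reps M 1).card =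
      (reps (p ^ 2 * M) ((1 + v) % 3)).card + (reps (p ^ 2 * M) ((1 + -v) % 3)).card := by
  obtain ⟨huv', hv'⟩ := neg_parameters huv hv
  have hp0 : (p : ℤ) ≠ 0 := by exact_mod_cast hp.ne_zero
  have hp3 := sq_emod_three hp hp5
  set A := (reps (p ^ 2 * M) ((1 + v) % 3)).image (twist u v) with hA
  set B := (reps (p ^ 2 * M) ((1 + -v) % 3)).image (twist u (-v)) with hB
  have hunion : reps (p ^ 2 * (p ^ 2 * M)) 1 = A ∪ B := by
    apply Finset.Subset.antisymm
    · intro z hz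
      have h1 := (mem_reps.mp hz).1
      rcases dvd_add_or_dvd_sub_of_pow_four hp hp5 huv hv (X := z.1) (Y := z.2)
        ⟨M, by rw [h1]; push_cast; ring⟩ with h | h
      · exact Finset.mem_union_left _ (mem_image_twist hp hp5 huv hu hv hz h)
      · refine Finset.mem_union_right _ (mem_image_twist hp hp5 huv' hu hv' hz ?_)
        rwa [show u * z.1 + 3 * -v * z.2 = u * z.1 - 3 * v * z.2 by ring]
    · exact Finset.union_subset (image_twist_subset huv hu) (image_twist_subset huv' hu)
  have hinter : A ∩ B = (reps M 1).image (fun z => ((p : ℤ) ^ 2 * z.1, (p : ℤ) ^ 2 * z.2)) := by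
    obtain ⟨c, hc⟩ : ∃ c, (p : ℤ) ^ 2 = 3 * c + 1 := ⟨(p : ℤ) ^ 2 / 3, by lia⟩
    have hmem : ∀ x y : ℤ, (x, y) ∈ reps M 1 ↔
        ((p : ℤ) ^ 2 * x, (p : ℤ) ^ 2 * y) ∈ reps (p ^ 2 * (p ^ 2 * M)) 1 := by
      intro x y
      simp only [mem_reps]
      have e1 : ((p : ℤ) ^ 2 * x) % 3 = x % 3 := by
        rw [hc, show (3 * c + 1) * x = 3 * (c * x) + x by ring]; lia
      have e2 : ((p : ℤ) ^ 2 * y) % 3 = y % 3 := by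
        rw [hc, show (3 * c + 1) * y = 3 * (c * y) + y by ring]; lia
      rw [e1, e2]
      refine and_congr_left fun _ => ?_
      push_cast
      rw [show 2 * ((p : ℤ) ^ 2 * x) ^ 2 + 3 * ((p : ℤ) ^ 2 * y) ^ 2
        = (p : ℤ) ^ 2 * ((p : ℤ) ^ 2 * (2 * x ^ 2 + 3 * y ^ 2)) by ring,
        mul_right_inj' (pow_ne_zero 2 hp0), mul_right_inj' (pow_ne_zero 2 hp0)]
    ext ⟨X, Y⟩
    rw [Finset.mem_inter]
    constructor
    · rintro ⟨h1, h2⟩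
      have hz : (X, Y) ∈ reps (p ^ 2 * (p ^ 2 * M)) 1 := hunion ▸ Finset.mem_union_left _ h1
      obtain ⟨⟨x, rfl⟩, ⟨y, rfl⟩⟩ := dvd_sq_of_dvd_add_of_dvd_sub hp hp5 huv hv (X := X) (Y := Y)
        (dvd_of_mem_image_twist (z := (X, Y)) huv h1) (by
          have := dvd_of_mem_image_twist huv' h2
          rwa [show u * X + 3 * -v * Y = u * X - 3 * v * Y by ring] at this)
      exact Finset.mem_image.mpr ⟨(x, y), (hmem x y).mpr hz, rfl⟩
    · intro h
      obtain ⟨⟨x, y⟩, hw, h⟩ := Finset.mem_image.mp h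
      obtain ⟨rfl, rfl⟩ := Prod.mk.inj h
      have hz := (hmem x y).mp hw
      exact ⟨mem_image_twist hp hp5 huv hu hv hz ⟨u * x + 3 * v * y, by ring⟩,
        mem_image_twist hp hp5 huv' hu hv' hz ⟨u * x + 3 * -v * y, by ring⟩⟩
  have hcard := Finset.card_union_add_card_inter A B
  rw [← hunion, hinter, hA, hB, Finset.card_image_of_injective _ (twist_injective (huv ▸
    pow_ne_zero 2 hp0)), Finset.card_image_of_injective _ (twist_injective (huv' ▸
    pow_ne_zero 2 hp0)), Finset.card_image_of_injective] at hcard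
  · exact hcard
  · rintro ⟨a, b⟩ ⟨c, d⟩ h
    simpa only [Prod.mk.injEq, mul_right_inj' (pow_ne_zero 2 hp0)] using h

end Prime

section Parity

variable {p : ℕ}

theorem even_card_reps_pow {u v : ℤ} {M : ℕ} (hp : p.Prime) (hp5 : 5 ≤ p)
    (huv : u ^ 2 + 6 * v ^ 2 = (p : ℤ) ^ 2) (hu : u % 3 = 1) (hv : ¬ (p : ℤ) ∣ v) (hv3 : v % 3 = 1)
    (hM : ¬ p ∣ M) (hodd : Odd M) (k : ℕ) : Even (reps (p ^ (6 * k + 2) * M) 1).card := by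
  have e1 : (1 + v) % 3 = 2 := by lia
  have e2 : (1 + -v) % 3 = 0 := by lia
  have hpodd : Odd p := hp.odd_of_ne_two (by lia)
  have hrec : ∀ j, Even (reps (p ^ (j + 4) * M) 1).card ↔
      (Even (reps (p ^ (j + 2) * M) 1).card ↔ Even (reps (p ^ j * M) 1).card) := by
    intro j
    have h := card_reps_mul_sq_of_dvd (M := p ^ j * M) hp hp5 huv hu hv
    have h0 := even_card_reps_zero (hpodd.pow (n := j + 2) |>.mul hodd)
    rw [← mul_assoc (p ^ 2) (p ^ j), ← pow_add, ← mul_assoc, ← pow_add, e1, e2, card_reps_two,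
      show 2 + (2 + j) = j + 4 by lia, add_comm 2 j] at h
    have h' := congrArg Even h
    simp only [Nat.even_add, h0, eq_iff_iff] at h'
    tauto
  induction k with
  | zero =>
    have h := card_reps_mul_sq_of_not_dvd hp hp5 huv hu hv hM
    rw [e1, e2, card_reps_two] at h
    rw [mul_zero, zero_add, h]
    have h0 := even_card_reps_zero hodd
    rw [add_right_comm]
    exact (Even.add_self _).add h0
  | succ k ih =>
    have h1 := hrec (6 * k + 2)
    have h2 := hrec (6 * k + 4)
    rw [show 6 * (k + 1) + 2 = 6 * k + 4 + 4 by lia]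
    rw [show 6 * k + 2 + 4 = 6 * k + 4 + 2 by lia, show 6 * k + 2 + 2 = 6 * k + 4 by lia] at h1
    tauto

theorem card_reps_five : (reps 5 1).card = 1 := by
  rw [Finset.card_eq_one]
  refine ⟨(1, 1), ?_⟩
  ext ⟨x, y⟩
  simp only [mem_reps, Finset.mem_singleton, Prod.mk.injEq]
  constructor
  · rintro ⟨h1, h2, h3⟩
    push_cast at h1
    have hx : x ^ 2 < 2 ^ 2 := by nlinarith [sq_nonneg y]
    have hy : y ^ 2 < 2 ^ 2 := by nlinarith [sq_nonneg x]
    have := abs_lt.mp (abs_lt_of_sq_lt_sq hx (by norm_num))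
    have := abs_lt.mp (abs_lt_of_sq_lt_sq hy (by norm_num))
    have hx' : x = 1 := by lia
    subst hx'
    exact ⟨rfl, by lia⟩
  · rintro ⟨rfl, rfl⟩
    norm_num

theorem not_dvd_of_ne_zero {u v : ℤ} (hp : p.Prime) (huv : u ^ 2 + 6 * v ^ 2 = (p : ℤ) ^ 2)
    (hv : v ≠ 0) : ¬ (p : ℤ) ∣ v := by
  rintro ⟨w, rfl⟩
  have hw : w ≠ 0 := right_ne_zero_of_mul hv
  have hp0 : (0 : ℤ) < p := by exact_mod_cast hp.pos
  have h1 : 1 ≤ w ^ 2 := by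
    have := sq_pos_of_ne_zero hw
    lia
  have h2 : 0 < (p : ℤ) ^ 2 := by positivity
  nlinarith [sq_nonneg u, mul_pow (p : ℤ) w 2]

theorem exists_sq_add_six_mul_sq (hp : p.Prime) (hp5 : 5 ≤ p)
    (h : p ≠ 5 → Even (reps (p ^ 2 * 5) 1).card) :
    ∃ u v : ℤ, u ^ 2 + 6 * v ^ 2 = (p : ℤ) ^ 2 ∧ u % 3 = 1 ∧ ¬ (p : ℤ) ∣ v ∧ v % 3 = 1 := by
  by_cases hp' : p = 5
  · subst hp'
    exact ⟨1, -2, by norm_num⟩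
  specialize h hp'
  have hp3 := sq_emod_three hp hp5
  have hpd : ¬ p ∣ 5 := fun hd => hp' ((Nat.prime_dvd_prime_iff_eq hp Nat.prime_five).mp hd)
  have hp0 : (p : ℤ) ≠ 0 := by exact_mod_cast hp.ne_zero
  suffices ∃ u v : ℤ, u ^ 2 + 6 * v ^ 2 = (p : ℤ) ^ 2 ∧ v ≠ 0 by
    obtain ⟨u, v, huv, hv0⟩ := this
    have hv := not_dvd_of_ne_zero hp huv hv0
    have hu3 : u % 3 = 1 ∨ u % 3 = 2 := by
      have : u % 3 ≠ 0 := fun h0 => by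
        obtain ⟨a, rfl⟩ := Int.dvd_of_emod_eq_zero h0
        rw [← huv, show (3 * a) ^ 2 + 6 * v ^ 2 = 3 * (3 * a ^ 2 + 2 * v ^ 2) by ring] at hp3
        lia
      lia
    obtain ⟨u', hu', hu3'⟩ : ∃ u' : ℤ, u' ^ 2 = u ^ 2 ∧ u' % 3 = 1 := by
      rcases hu3 with h | h
      · exact ⟨u, rfl, h⟩
      · exact ⟨-u, neg_sq u, by lia⟩
    rw [← hu'] at huv
    have hv3 : v % 3 ≠ 0 := fun h0 => by
      have hc := card_reps_mul_sq_of_not_dvd hp hp5 huv hu3' hv hpd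
      rw [show (1 + v) % 3 = 1 by lia, show (1 + -v) % 3 = 1 by lia, card_reps_five] at hc
      rw [hc] at h
      exact absurd h (by decide)
    have : v % 3 = 1 ∨ v % 3 = 2 := by lia
    rcases this with h | h
    · exact ⟨u', v, huv, hu3', hv, h⟩
    · exact ⟨u', -v, by rwa [neg_sq], hu3', by rwa [dvd_neg], by lia⟩
  obtain ⟨q, hq, hq3⟩ : ∃ q : ℤ, q ^ 2 = (p : ℤ) ^ 2 ∧ q % 3 = 1 := by
    have : (p : ℤ) % 3 = 0 ∨ (p : ℤ) % 3 = 1 ∨ (p : ℤ) % 3 = 2 := by lia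
    rcases this with h | h | h
    · simp [pow_two, Int.mul_emod, h] at hp3
    · exact ⟨p, rfl, h⟩
    · exact ⟨-p, by ring, by lia⟩
  have hmem : (q, q) ∈ reps (p ^ 2 * 5) 1 := by
    refine mem_reps.mpr ⟨?_, hq3, hq3⟩
    push_cast
    rw [hq]
    ring
  obtain ⟨⟨X, Y⟩, hXY, hne⟩ : ∃ z ∈ reps (p ^ 2 * 5) 1, z ≠ (q, q) := by
    apply Finset.exists_mem_ne
    obtain ⟨m, hm⟩ := h
    have := Finset.card_pos.mpr ⟨_, hmem⟩
    lia
  simp only [mem_reps] at hXY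
  obtain ⟨h1, h2, h3⟩ := hXY
  push_cast at h1
  have hlin : ∀ y : ℤ, y ^ 2 = Y ^ 2 → (5 : ℤ) ∣ y - X → y - X ≠ 0 →
      ∃ u v : ℤ, u ^ 2 + 6 * v ^ 2 = (p : ℤ) ^ 2 ∧ v ≠ 0 := by
    rintro y hy ⟨v, hv⟩ h0
    refine ⟨X + 3 * v, v, ?_, ?_⟩
    · obtain rfl : y = X + 5 * v := by linarith
      rw [← hy] at h1
      linarith
    · rintro rfl
      exact h0 (by linarith)
  have h5 : (5 : ℤ) ∣ (Y - X) * (Y + X) := by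
    have : (5 : ℤ) ∣ 3 * ((Y - X) * (Y + X)) := ⟨p ^ 2 - X ^ 2, by linarith⟩
    exact (show IsCoprime (5 : ℤ) 3 by norm_num).dvd_of_dvd_mul_left this
  have hXq : X ^ 2 = Y ^ 2 → X = q ∧ Y = q := by
    intro hXY
    have hX : X ^ 2 = q ^ 2 := by rw [hq]; linarith
    have hY : Y ^ 2 = q ^ 2 := by rw [← hXY, hX]
    rcases sq_eq_sq_iff_eq_or_eq_neg.mp hX with h | h <;>
      rcases sq_eq_sq_iff_eq_or_eq_neg.mp hY with h' | h' <;> constructor <;> lia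
  have hsq : X ^ 2 ≠ Y ^ 2 := fun h => hne (Prod.ext (hXq h).1 (hXq h).2)
  rcases (Int.prime_iff_natAbs_prime.mpr (by norm_num : Nat.Prime (5 : ℤ).natAbs)).dvd_or_dvd h5
    with h | h
  · refine hlin Y rfl h fun h0 => hsq ?_
    rw [sub_eq_zero.mp h0]
  · refine hlin (-Y) (neg_sq Y) ?_ fun h0 => hsq ?_
    · rw [show -Y - X = -(Y + X) by ring]
      exact h.neg_right
    · rw [← neg_sq Y, sub_eq_zero.mp h0]

end Parity

section GeneratingFunctions

open PowerSeries Filter Topology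
open scoped PowerSeries.WithPiTopology

local notation "𝔼" => pentagonalSeries (ZMod 2)

theorem hasProd_one_sub_X_pow_mul [TopologicalSpace (ZMod 2)] {t : ℕ} (ht : t ≠ 0) :
    HasProd (fun n : ℕ => (1 - X ^ (t * (n + 1)) : (ZMod 2)⟦X⟧)) (expand t ht 𝔼) := by
  rw [HasProd, WithPiTopology.tendsto_iff_coeff_tendsto]
  intro d
  refine tendsto_nhds_of_eventually_eq ?_
  have hexp : ∀ s : Finset ℕ, ∏ n ∈ s, (1 - X ^ (t * (n + 1)) : (ZMod 2)⟦X⟧)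
      = expand t ht (∏ n ∈ s, (1 - X ^ (n + 1))) := fun s => by
    rw [map_prod]
    simp [pow_mul]
  filter_upwards [coeff_prod_one_sub_X_pow_eventually_eq (ZMod 2) (d / t)] with s hs
  rw [hexp, coeff_expand, coeff_expand, hs]

/-- The generating function of `t`-regular partitions, modulo `2`. -/
noncomputable def regularSeries (t : ℕ) : (ZMod 2)⟦X⟧ :=
  PowerSeries.mk fun n => (regularPartitionCount t n : ZMod 2)

theorem regularSeries_mul_pentagonalSeries {t : ℕ} (ht : t ≠ 0) :
    regularSeries t * 𝔼 = expand t ht 𝔼 := by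
  let : TopologicalSpace (ZMod 2) := ⊥
  have : DiscreteTopology (ZMod 2) := ⟨rfl⟩
  have h1 : regularSeries t =
      PowerSeries.mk fun n => ((Nat.Partition.countRestricted n t).card : ZMod 2) := by
    ext n
    rw [regularSeries, coeff_mk, coeff_mk, ← Nat.Partition.card_restricted_eq_card_countRestricted
      n (Nat.pos_of_ne_zero ht), regularPartitionCount, Nat.Partition.restricted,
      Nat.card_eq_fintype_card, Fintype.card_subtype]
  have h2 := (Nat.Partition.hasProd_powerSeriesMk_card_countRestricted (ZMod 2)
    (Nat.pos_of_ne_zero ht)).mul (WithPiTopology.hasProd_one_sub_X_pow (ZMod 2))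
  have h3 : (fun n : ℕ => (∑ j ∈ Finset.range t, X ^ ((n + 1) * j)) * (1 - X ^ (n + 1)))
      = fun n : ℕ => (1 - X ^ (t * (n + 1)) : (ZMod 2)⟦X⟧) := by
    funext n
    rw [Finset.sum_congr rfl fun j _ => pow_mul (X : (ZMod 2)⟦X⟧) (n + 1) j, geom_sum_mul_neg,
      ← pow_mul, mul_comm t]
  rw [← h1, h3] at h2
  exact h2.unique (hasProd_one_sub_X_pow_mul ht)

theorem expand_two_eq_sq (f : (ZMod 2)⟦X⟧) : expand 2 two_ne_zero f = f ^ 2 := by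
  have := MvPowerSeries.map_frobenius_expand (σ := Unit) 2 two_ne_zero (f := f)
  rwa [ZMod.frobenius_zmod, MvPowerSeries.map_id] at this

theorem expand_four_eq_pow (f : (ZMod 2)⟦X⟧) : expand 4 four_ne_zero f = f ^ 4 := by
  have := expand_mul 2 two_ne_zero 2 two_ne_zero f
  rw [expand_two_eq_sq, expand_two_eq_sq, ← pow_mul] at this
  exact this

theorem regularSeries_four_mul_regularSeries_three :
    regularSeries 4 * regularSeries 3 = 𝔼 ^ 2 * expand 3 three_ne_zero 𝔼 := by
  have h0 : 𝔼 ≠ 0 := fun h => by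
    have := coeff_pentagonalSeries_pentagonal (ZMod 2) 0
    rw [h] at this
    simp at this
  apply mul_right_cancel₀ (pow_ne_zero 2 h0)
  calc regularSeries 4 * regularSeries 3 * 𝔼 ^ 2
      = (regularSeries 4 * 𝔼) * (regularSeries 3 * 𝔼) := by ring
    _ = _ := by
      rw [regularSeries_mul_pentagonalSeries four_ne_zero,
        regularSeries_mul_pentagonalSeries three_ne_zero, expand_four_eq_pow]
      ring

theorem natCast_B (n : ℕ) :
    (B 4 3 n : ZMod 2) = coeff n (𝔼 ^ 2 * expand 3 three_ne_zero 𝔼) := by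
  rw [← regularSeries_four_mul_regularSeries_three, coeff_mul,
    Finset.Nat.sum_antidiagonal_eq_sum_range_succ_mk, B]
  simp [regularSeries]

theorem intCast_a1 (n : ℕ) :
    (a1 n : ZMod 2) = coeff n (𝔼 ^ 2 * expand 3 three_ne_zero 𝔼) := by
  let : TopologicalSpace (ZMod 2) := ⊥
  have : DiscreteTopology (ZMod 2) := ⟨rfl⟩
  let f : ℕ → (ZMod 2)⟦X⟧ := fun k => (1 - X ^ (k + 1)) ^ 2 * (1 - X ^ (3 * (k + 1)))
  have hprod : HasProd f (𝔼 ^ 2 * expand 3 three_ne_zero 𝔼) := by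
    have h := WithPiTopology.hasProd_one_sub_X_pow (ZMod 2)
    have := (h.mul h).mul (hasProd_one_sub_X_pow_mul three_ne_zero)
    simpa only [← pow_two] using this
  have htend := (WithPiTopology.tendsto_iff_coeff_tendsto (R := ZMod 2) _ _ _).mp
    hprod.tendsto_prod_nat n
  rw [nhds_discrete, tendsto_pure] at htend
  obtain ⟨m, hm⟩ := htend.exists_forall_of_atTop
  have hstab : ∀ j, coeff n (∏ k ∈ Finset.range (n + j), f k)
      = coeff n (∏ k ∈ Finset.range n, f k) := by
    intro j
    induction j with
    | zero => rfl
    | succ j ih =>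
      rw [← ih, ← add_assoc, Finset.prod_range_succ]
      obtain ⟨g, hg⟩ : ∃ g, f (n + j) = 1 + X ^ (n + j + 1) * g := by
        refine ⟨-2 + X ^ (n + j + 1) + -(1 - X ^ (n + j + 1)) ^ 2 * X ^ (2 * (n + j + 1)), ?_⟩
        simp only [f]
        ring
      rw [hg, mul_add, mul_one, map_add, mul_left_comm, coeff_X_pow_mul', if_neg (by lia),
        add_zero]
  rw [← hm (n + m) (by lia), hstab, a1]
  have hcoe : ∀ m, ((∏ k ∈ Finset.Icc 1 m, ((1 - Polynomial.X ^ k) ^ 2 *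
      (1 - Polynomial.X ^ (3 * k)) : Polynomial ℤ)).map (Int.castRingHom (ZMod 2)) : (ZMod 2)⟦X⟧)
        = ∏ k ∈ Finset.range m, f k := by
    intro m
    induction m with
    | zero => simp
    | succ m ih =>
      rw [Finset.prod_Icc_succ_top (by lia), Finset.prod_range_succ, Polynomial.map_mul,
        Polynomial.coe_mul, ih]
      simp [f, Polynomial.coe_sub]
  rw [← hcoe, Polynomial.coeff_coe, Polynomial.coeff_map]
  rfl

theorem coeff_expand_pentagonalSeries {t : ℕ} (ht : t ≠ 0) (n : ℕ) [Decidable (∃ k, t * pentagonal k = n)] :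
    coeff n (expand t ht 𝔼) = if ∃ k, t * pentagonal k = n then 1 else 0 := by
  split_ifs with h
  · obtain ⟨k, rfl⟩ := h
    rw [coeff_expand_mul, coeff_pentagonalSeries_pentagonal]
    rcases Int.units_eq_one_or (Int.negOnePow k) with h | h <;> rw [h] <;> decide
  · rw [coeff_expand]
    split_ifs with hd
    · obtain ⟨m, rfl⟩ := hd
      rw [Nat.mul_div_cancel_left _ (Nat.pos_of_ne_zero ht)]
      apply coeff_pentagonalSeries_eq_zero
      rintro ⟨k, rfl⟩
      exact h ⟨k, rfl⟩
    · rfl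

theorem coeff_eq_card_reps (n : ℕ) :
    coeff n (𝔼 ^ 2 * expand 3 three_ne_zero 𝔼) = ((reps (24 * n + 5) 1).card : ZMod 2) := by
  classical
  have hpent : ∀ k : ℤ, 24 * (pentagonal k : ℤ) + 1 = (1 - 6 * k) ^ 2 := fun k => by
    linear_combination 12 * two_mul_natCast_pentagonal k
  rw [← expand_two_eq_sq, coeff_mul]
  simp only [coeff_expand_pentagonalSeries, ← ite_and, mul_ite, mul_one, mul_zero]
  rw [Finset.sum_boole]
  congr 1
  symm
  have hodd : ∀ z ∈ reps (24 * n + 5) 1, ∃ k l : ℤ, z = (1 - 6 * k, 1 - 6 * l) := by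
    rintro ⟨x, y⟩ hz
    simp only [mem_reps] at hz
    obtain ⟨h1, h2, h3⟩ := hz
    push_cast at h1
    have hy : y % 2 = 1 := by
      rcases Int.emod_two_eq_zero_or_one y with h | h
      · obtain ⟨a, rfl⟩ := Int.dvd_of_emod_eq_zero h
        rw [show 2 * x ^ 2 + 3 * (2 * a) ^ 2 = 2 * (x ^ 2 + 6 * a ^ 2) by ring] at h1
        lia
      · exact h
    have hx : x % 2 = 1 := by
      rcases Int.emod_two_eq_zero_or_one x with h | h
      · obtain ⟨a, rfl⟩ := Int.dvd_of_emod_eq_zero h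
        have hy8 := Int.sq_mod_four_eq_one_of_odd (Int.odd_iff.mpr hy)
        obtain ⟨b, rfl⟩ : ∃ b, y = 2 * b + 1 := ⟨y / 2, by lia⟩
        obtain ⟨c, hc⟩ := Int.even_mul_succ_self b
        have : 8 * a ^ 2 + 12 * (c + c) + 3 = 24 * n + 5 := by rw [← hc, ← h1]; ring
        lia
      · exact h
    exact ⟨(1 - x) / 6, (1 - y) / 6, Prod.ext (by simp only; lia) (by simp only; lia)⟩
  refine Finset.card_nbij
    (fun z => (2 * pentagonal ((1 - z.1) / 6), 3 * pentagonal ((1 - z.2) / 6))) ?_ ?_ ?_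
  · intro z hz
    obtain ⟨k, l, rfl⟩ := hodd z hz
    have h1 := (mem_reps.mp hz).1
    have hk : (1 - (1 - 6 * k)) / 6 = k := by lia
    have hl : (1 - (1 - 6 * l)) / 6 = l := by lia
    simp only [Finset.mem_coe, Finset.mem_filter, Finset.HasAntidiagonal.mem_antidiagonal, hk, hl]
    refine ⟨?_, ⟨_, rfl⟩, ⟨_, rfl⟩⟩
    simp only [← hpent] at h1
    lia
  · intro z hz w hw h
    obtain ⟨k, l, rfl⟩ := hodd z hz
    obtain ⟨k', l', rfl⟩ := hodd w hw
    simp only [Prod.mk.injEq, mul_right_inj' (two_ne_zero (α := ℕ)),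
      mul_right_inj' (three_ne_zero (α := ℕ)), pentagonal_inj] at h ⊢
    lia
  · rintro ⟨i, j⟩ hij
    simp only [Finset.mem_coe, Finset.mem_filter, Finset.HasAntidiagonal.mem_antidiagonal] at hij
    obtain ⟨h, ⟨l, rfl⟩, ⟨k, rfl⟩⟩ := hij
    refine ⟨(1 - 6 * k, 1 - 6 * l), mem_reps.mpr ⟨?_, by simp only; lia, by simp only; lia⟩, ?_⟩
    · simp only [← hpent]
      push_cast
      lia
    · have hk : (1 - (1 - 6 * k)) / 6 = k := by lia
      have hl : (1 - (1 - 6 * l)) / 6 = l := by lia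
      simp only [hk, hl]

end GeneratingFunctions

theorem even_B_iff (n : ℕ) : Even (B 4 3 n) ↔ Even (reps (24 * n + 5) 1).card := by
  rw [← ZMod.natCast_eq_zero_iff_even, ← ZMod.natCast_eq_zero_iff_even, natCast_B,
    coeff_eq_card_reps]

theorem even_a1_iff (n : ℕ) : Even (a1 n) ↔ Even (reps (24 * n + 5) 1).card := by
  rw [← ZMod.intCast_eq_zero_iff_even, ← ZMod.natCast_eq_zero_iff_even, intCast_a1,
    coeff_eq_card_reps]

theorem odd_legendreSym_iff {p : ℕ} [Fact p.Prime] {a : ℤ} :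
    Odd (legendreSym p a) ↔ ¬ (p : ℤ) ∣ a := by
  rw [← ZMod.intCast_zmod_eq_zero_iff_dvd]
  by_cases h : (a : ZMod p) = 0
  · rw [(legendreSym.eq_zero_iff p a).mpr h]
    simp [h]
  · rcases legendreSym.eq_one_or_neg_one p h with h' | h' <;> simp [h, h']

theorem twenty_four_dvd_pow_sub_one {p : ℕ} (hp : p.Prime) (hp5 : 5 ≤ p) (e : ℕ) :
    24 ∣ p ^ (2 * e) - 1 := by
  have h2 : p % 24 % 2 ≠ 0 := fun h => by
    have := (Nat.prime_dvd_prime_iff_eq Nat.prime_two hp).mp (by lia)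
    lia
  have h3 : p % 24 % 3 ≠ 0 := fun h => by
    have := (Nat.prime_dvd_prime_iff_eq Nat.prime_three hp).mp (by lia)
    lia
  have hsq : p ^ 2 ≡ 1 [MOD 24] := by
    have h : p % 24 < 24 := Nat.mod_lt _ (by lia)
    rw [Nat.ModEq, Nat.pow_mod]
    generalize p % 24 = r at h2 h3 h
    interval_cases r <;> simp_all
  have := (hsq.pow e).symm
  rw [one_pow, ← pow_mul] at this
  exact (Nat.modEq_iff_dvd' (Nat.one_le_pow _ _ hp.pos)).mp this

/-- Theorem 1.8(iii). -/
theorem B_4_3_cong_iii (p : ℕ) (hp : p.Prime) (hp5 : 5 ≤ p)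
    (hw : ¬ w1 p hp ≡ 0 [ZMOD 2]) (n k : ℕ)
    (hcond : w1 p hp
      ≡ @legendreSym p ⟨hp⟩ (-6 * (n : ℤ) - 1 + ((p ^ 2 - 1) / 4 : ℕ)) [ZMOD 2]) :
    B 4 3 (p ^ (6 * k + 2) * n + 5 * (p ^ (6 * k + 2) - 1) / 24) ≡ 0 [MOD 2] := by
  have : Fact p.Prime := ⟨hp⟩
  have hp' := Nat.prime_iff_prime_int.mp hp
  have hwodd : Odd (w1 p hp) := by
    rw [← Int.not_even_iff_odd, Int.even_iff]
    exact hw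
  have h24 := twenty_four_dvd_pow_sub_one hp hp5
  have hpos : ∀ e, 1 ≤ p ^ e := fun e => Nat.one_le_pow _ _ hp.pos
  -- the parity of `w1 p` detects the representations of `5 p ^ 2`
  have hrep : p ≠ 5 → Even (reps (p ^ 2 * 5) 1).card := fun hne => by
    obtain ⟨c, hc⟩ := h24 1
    have hp1 := hpos 2
    have hdelta : 5 * (p ^ 2 - 1) / 24 = 5 * c := by lia
    have hl6 : Odd (legendreSym p (-6)) := odd_legendreSym_iff.mpr fun h => by
      have h6 : p ∣ 6 := by
        have := (dvd_neg (a := (p : ℤ)) (b := 6)).mp h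
        exact_mod_cast this
      have := Nat.le_of_dvd (by norm_num) h6
      interval_cases p
      · exact absurd rfl hne
      · exact absurd hp (by norm_num)
    have hlm : Odd (legendreSym p (-((5 * (p ^ 2 - 1) / 24 : ℕ) : ℤ))) :=
      odd_legendreSym_iff.mpr fun h => by
        rw [dvd_neg, hdelta] at h
        have h1 : p ∣ 5 * c := by exact_mod_cast h
        have h2 : p ∣ 5 := by
          have h3 : 5 * p ^ 2 = 24 * (5 * c) + 5 := by lia
          exact (Nat.dvd_add_right (h1.mul_left 24)).mp
            (h3 ▸ (dvd_pow_self p two_ne_zero).mul_left 5)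
        exact hne ((Nat.prime_dvd_prime_iff_eq hp Nat.prime_five).mp h2)
    have ha : Even (a1 (5 * (p ^ 2 - 1) / 24)) := by
      rw [w1] at hwodd
      by_contra hodd
      exact Int.not_even_iff_odd.mpr hwodd
        ((Int.not_even_iff_odd.mp hodd).add_odd (hl6.mul hlm))
    rw [even_a1_iff, hdelta] at ha
    rwa [show p ^ 2 * 5 = 24 * (5 * c) + 5 by lia]
  have hndvd : ¬ p ∣ 24 * n + 5 := fun hd => by
    have hodd : Odd (legendreSym p (-6 * (n : ℤ) - 1 + ((p ^ 2 - 1) / 4 : ℕ))) := by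
      rw [Int.odd_iff] at hwodd ⊢
      exact Eq.trans hcond.symm hwodd
    refine odd_legendreSym_iff.mp hodd ?_
    obtain ⟨c, hc⟩ := h24 1
    have hp1 := hpos 2
    have hq : (p ^ 2 - 1) / 4 = 6 * c := by lia
    have hc' : (p : ℤ) ^ 2 = 24 * c + 1 := by
      have : p ^ 2 = 24 * c + 1 := by lia
      exact_mod_cast this
    have h4 : (p : ℤ) ∣ 4 * (-6 * (n : ℤ) - 1 + ((p ^ 2 - 1) / 4 : ℕ)) := by
      have : 4 * (-6 * (n : ℤ) - 1 + ((p ^ 2 - 1) / 4 : ℕ)) = (p : ℤ) ^ 2 - (24 * n + 5 : ℕ) := by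
        rw [hq, hc']
        push_cast
        ring
      rw [this]
      exact dvd_sub (dvd_pow_self _ two_ne_zero) (Int.natCast_dvd_natCast.mpr hd)
    refine (hp'.dvd_or_dvd h4).resolve_left fun h => ?_
    have := Nat.le_of_dvd (by norm_num) (show p ∣ 4 by exact_mod_cast h)
    lia
  obtain ⟨u, v, huv, hu, hv, hv3⟩ := exists_sq_add_six_mul_sq hp hp5 hrep
  have heven := even_card_reps_pow hp hp5 huv hu hv hv3 hndvd (by grind) k
  refine Nat.even_iff.mp ((even_B_iff _).mpr ?_)
  obtain ⟨c, hc⟩ := h24 (3 * k + 1)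
  have hp1 := hpos (6 * k + 2)
  rw [show 2 * (3 * k + 1) = 6 * k + 2 by ring] at hc
  have hdelta : 5 * (p ^ (6 * k + 2) - 1) / 24 = 5 * c := by lia
  rw [hdelta]
  have hpow : p ^ (6 * k + 2) = 24 * c + 1 := by lia
  convert heven using 3
  rw [hpow]
  ring
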